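/- Every convex degree-three foliation of ℙ²(ℂ) whose inflection divisor is reduced — i.e. whose extactic polynomial E (of degree 9) is squarefree — is linearly conjugate to the Fermat foliation F₃, given in the affine chart z = 1 by (x³ − x)dy − (y³ − y)dx. -/

import Mathlib

open MvPolynomial

noncomputable section

/-- The derivation associated to the homogeneous vector field
`Z = A ∂x + B ∂y + C ∂z`. -/
def Zop (A B Cz f : MvPolynomial (Fin 3) ℂ) : MvPolynomial (Fin 3) ℂ :=
  A * pderiv 0 f + B * pderiv 1 f + Cz * pderiv 2 f

/-- The extactic polynomial of the vector field `Z = A ∂x + B ∂y + C ∂z`, cutting out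
the inflection divisor of the associated foliation. -/
def extactic (A B Cz : MvPolynomial (Fin 3) ℂ) : MvPolynomial (Fin 3) ℂ :=
  Matrix.det
    !![X 0, Zop A B Cz (X 0), Zop A B Cz (Zop A B Cz (X 0));
       X 1, Zop A B Cz (X 1), Zop A B Cz (Zop A B Cz (X 1));
       X 2, Zop A B Cz (X 2), Zop A B Cz (Zop A B Cz (X 2))]

/-- The line `ker L` is invariant by the foliation defined by `Z`: `L ∣ Z(L)`. -/
def LineInvZ (A B Cz L : MvPolynomial (Fin 3) ℂ) : Prop :=
  L ∣ Zop A B Cz L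

/-- The foliation defined by `Z = A ∂x + B ∂y + C ∂z` is convex: its extactic
polynomial is a product of linear forms, each defining an invariant line. -/
def ConvexFol (A B Cz : MvPolynomial (Fin 3) ℂ) : Prop :=
  ∃ (n : ℕ) (c : ℂ) (L : Fin n → MvPolynomial (Fin 3) ℂ), c ≠ 0 ∧
    (∀ i, (L i).IsHomogeneous 1 ∧ L i ≠ 0 ∧ LineInvZ A B Cz (L i)) ∧
    extactic A B Cz = C c * ∏ i, L i

/-- The projective 1-form `i_R i_Z (dx ∧ dy ∧ dz)` of the foliation defined by the
vector field `Z = A ∂x + B ∂y + C ∂z`. -/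
def OmZ (A B Cz : MvPolynomial (Fin 3) ℂ) : Fin 3 → MvPolynomial (Fin 3) ℂ :=
  ![X 2 * B - X 1 * Cz, X 0 * Cz - X 2 * A, X 1 * A - X 0 * B]

/-- Substitution of the linear change of variables on `ℂ³` given by the matrix `M`. -/
def subst3 (M : Matrix (Fin 3) (Fin 3) ℂ) (P : MvPolynomial (Fin 3) ℂ) :
    MvPolynomial (Fin 3) ℂ :=
  aeval (fun i => ∑ j, C (M i j) * X j) P

/-- Pullback of the 1-form with coefficient vector `Ω` by the linear map of matrix `M`. -/
def pb3 (M : Matrix (Fin 3) (Fin 3) ℂ) (Ω : Fin 3 → MvPolynomial (Fin 3) ℂ) :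
    Fin 3 → MvPolynomial (Fin 3) ℂ :=
  fun i => ∑ j, C (M j i) * subst3 M (Ω j)

/-- Two foliations (given by their projective 1-forms) are linearly conjugate:
`T*Ω = c·Ω'` for some `T ∈ GL₃(ℂ)` and `c ∈ ℂ*`. -/
def LinConj3 (Ω Ω' : Fin 3 → MvPolynomial (Fin 3) ℂ) : Prop :=
  ∃ (M : Matrix (Fin 3) (Fin 3) ℂ) (c : ℂ), IsUnit M.det ∧ c ≠ 0 ∧
    pb3 M Ω = fun i => C c * Ω' i

/-- `Ω` defines a degree-`d` foliation of `ℙ²(ℂ)`. -/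
def IsFolDeg (d : ℕ) (Ω : Fin 3 → MvPolynomial (Fin 3) ℂ) : Prop :=
  Ω ≠ 0 ∧ (∀ i, (Ω i).IsHomogeneous (d + 1)) ∧
    X 0 * Ω 0 + X 1 * Ω 1 + X 2 * Ω 2 = 0 ∧
    ∀ h : MvPolynomial (Fin 3) ℂ, (∀ i, h ∣ Ω i) → IsUnit h

def lf {n : ℕ} (u : Fin n → ℂ) : MvPolynomial (Fin n) ℂ := ∑ i, C (u i) * X i

theorem eval_lf {n : ℕ} (u x : Fin n → ℂ) : eval x (lf u) = ∑ i, u i * x i := by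
  simp [lf]

theorem lf_hom {n : ℕ} (u : Fin n → ℂ) : (lf u).IsHomogeneous 1 :=
  IsHomogeneous.sum _ _ _ fun _ _ => isHomogeneous_C_mul_X _ _

theorem lf_smul {n : ℕ} (c : ℂ) (u : Fin n → ℂ) : lf (c • u) = C c * lf u := by
  simp [lf, Finset.mul_sum, mul_assoc]

theorem coeff_lf {n : ℕ} (u : Fin n → ℂ) (i : Fin n) :
    (lf u).coeff (Finsupp.single i 1) = u i := by
  have h := eval_lf u (Pi.single i 1)
  simp only [lf, coeff_sum, coeff_C_mul, coeff_X]
  rw [Finset.sum_eq_single i]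
  · simp
  · intro j _ hj
    rw [if_neg, mul_zero]
    intro h
    exact hj (Finsupp.single_left_injective one_ne_zero h)
  · simp

theorem lf_ne {n : ℕ} (u : Fin n → ℂ) (hu : u ≠ 0) : lf u ≠ 0 := by
  intro h
  apply hu
  funext i
  rw [← coeff_lf u i, h]; simp

theorem lf_irr {n : ℕ} (u : Fin n → ℂ) (hu : u ≠ 0) : Irreducible (lf u) := by
  apply irreducible_of_totalDegree_eq_one ((lf_hom u).totalDegree (lf_ne u hu))
  intro x hx
  rw [isUnit_iff_ne_zero]
  rintro rfl
  apply hu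
  funext i
  have := hx (Finsupp.single i 1)
  rw [coeff_lf] at this
  simpa using this

theorem lf_prime {n : ℕ} (u : Fin n → ℂ) (hu : u ≠ 0) : Prime (lf u) :=
  (lf_irr u hu).prime

theorem lf_dvd_of_vanish {n : ℕ} (u : Fin n → ℂ) (hu : u ≠ 0) (f : MvPolynomial (Fin n) ℂ)
    (h : ∀ x : Fin n → ℂ, ∑ i, u i * x i = 0 → eval x f = 0) : lf u ∣ f := by
  obtain ⟨i0, hi0⟩ : ∃ i, u i ≠ 0 := by
    by_contra hc; push Not at hc; exact hu (funext hc)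
  let w : Fin n → MvPolynomial (Fin n) ℂ := fun i =>
    X i - if i = i0 then C (u i0)⁻¹ * lf u else 0
  have h0 : aeval w f = 0 := by
    apply MvPolynomial.funext
    intro x
    have e : eval x (aeval w f) = eval (fun i => eval x (w i)) f := by
      rw [← coe_aeval_eq_eval, ← coe_aeval_eq_eval]
      have : ((aeval x : MvPolynomial (Fin n) ℂ →ₐ[ℂ] ℂ).comp (aeval w)) =
        aeval (fun i => eval x (w i)) := by
        apply MvPolynomial.algHom_ext; intro i; simp
      exact DFunLike.congr_fun this f
    rw [e, map_zero]
    apply h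
    simp only [w, map_sub, eval_X, mul_sub, Finset.sum_sub_distrib]
    rw [Finset.sum_eq_single (a := i0) (f := fun i => u i * eval x (if i = i0 then _ else _))]
    · simp only [if_true, map_mul, eval_C, eval_lf]
      field_simp
      ring
    · intro j _ hj; simp [hj]
    · simp
  rw [← Ideal.mem_span_singleton, ← Ideal.Quotient.eq_zero_iff_mem]
  have e : (Ideal.Quotient.mkₐ ℂ (Ideal.span {lf u})).comp (aeval w) =
      Ideal.Quotient.mkₐ ℂ (Ideal.span {lf u}) := by
    apply MvPolynomial.algHom_ext; intro i
    simp only [AlgHom.comp_apply, aeval_X, w]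
    rw [map_sub]
    have : Ideal.Quotient.mkₐ ℂ (Ideal.span {lf u}) (lf u) = 0 := by
      rw [Ideal.Quotient.mkₐ_eq_mk, Ideal.Quotient.eq_zero_iff_mem]
      exact Ideal.mem_span_singleton_self _
    split_ifs <;> simp [this, map_mul]
  have := DFunLike.congr_fun e f
  rw [AlgHom.comp_apply, h0, map_zero] at this
  exact this.symm

theorem eval_of_lf_dvd {n : ℕ} {u : Fin n → ℂ} {f : MvPolynomial (Fin n) ℂ} (h : lf u ∣ f)
    {x : Fin n → ℂ} (hx : ∑ i, u i * x i = 0) : eval x f = 0 := by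
  obtain ⟨g, rfl⟩ := h
  rw [map_mul, eval_lf, hx, zero_mul]

theorem lf_dvd_lf {n : ℕ} {u v : Fin n → ℂ} (hv : v ≠ 0) (h : lf u ∣ lf v) : ∃ c : ℂ, v = c • u := by
  obtain ⟨g, hg⟩ := h
  have hv' := lf_ne v hv
  have hg0 : g ≠ 0 := by rintro rfl; simp [hg] at hv'
  have hu0 : lf u ≠ 0 := by intro hu; simp [hg, hu] at hv'
  have h1 := totalDegree_mul_of_isDomain hu0 hg0
  rw [← hg, (lf_hom v).totalDegree hv', (lf_hom u).totalDegree hu0] at h1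
  have h2 : g.totalDegree = 0 := by omega
  rw [totalDegree_eq_zero_iff_eq_C] at h2
  refine ⟨coeff 0 g, ?_⟩
  funext i
  rw [← coeff_lf v i, hg, h2, mul_comm, coeff_C_mul, coeff_lf]; simp

theorem prod_lf_dvd {n : ℕ} {ι : Type*} (s : Finset ι) (u : ι → Fin n → ℂ)
    (hnp : ∀ i ∈ s, ∀ j ∈ s, i ≠ j → ∀ c : ℂ, u j ≠ c • u i) (h0 : ∀ i ∈ s, u i ≠ 0)
    (f : MvPolynomial (Fin n) ℂ)
    (hv : ∀ i ∈ s, ∀ x : Fin n → ℂ, ∑ k, u i k * x k = 0 → eval x f = 0) :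
    ∏ i ∈ s, lf (u i) ∣ f := by
  apply Finset.prod_dvd_of_isRelPrime
  · intro i hi j hj hij
    show IsRelPrime (lf (u i)) (lf (u j))
    rw [(lf_irr _ (h0 i hi)).isRelPrime_iff_not_dvd]
    intro hd
    obtain ⟨c, hc⟩ := lf_dvd_lf (h0 j hj) hd
    exact hnp i hi j hj hij c hc
  · intro i hi
    exact lf_dvd_of_vanish _ (h0 i hi) f (hv i hi)

theorem eq_C_mul_prod {n d : ℕ} {ι : Type*} (s : Finset ι) (u : ι → Fin n → ℂ)
    (hnp : ∀ i ∈ s, ∀ j ∈ s, i ≠ j → ∀ c : ℂ, u j ≠ c • u i) (h0 : ∀ i ∈ s, u i ≠ 0)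
    (f : MvPolynomial (Fin n) ℂ) (hf : f.IsHomogeneous d) (hf0 : f ≠ 0)
    (hv : ∀ i ∈ s, ∀ x : Fin n → ℂ, ∑ k, u i k * x k = 0 → eval x f = 0) :
    s.card ≤ d ∧ (s.card = d → ∃ k : ℂ, k ≠ 0 ∧ f = C k * ∏ i ∈ s, lf (u i)) := by
  obtain ⟨g, hg⟩ := prod_lf_dvd s u hnp h0 f hv
  have hp : (∏ i ∈ s, lf (u i)).IsHomogeneous s.card := by
    simpa using IsHomogeneous.prod s (fun i => lf (u i)) (fun _ => 1) (fun i _ => lf_hom _)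
  have hp0 : ∏ i ∈ s, lf (u i) ≠ 0 := by
    intro h; simp [hg, h] at hf0
  have hg0 : g ≠ 0 := by rintro rfl; simp [hg] at hf0
  have h1 := totalDegree_mul_of_isDomain hp0 hg0
  rw [← hg, hf.totalDegree hf0, hp.totalDegree hp0] at h1
  refine ⟨by omega, fun h => ?_⟩
  have h2 : g.totalDegree = 0 := by omega
  rw [totalDegree_eq_zero_iff_eq_C] at h2
  refine ⟨coeff 0 g, ?_, ?_⟩
  · intro h; rw [h] at h2; simp [h2] at hg0
  · rw [mul_comm, ← h2, hg]

theorem hom_eval_smul {n d : ℕ} {f : MvPolynomial (Fin n) ℂ} (hf : f.IsHomogeneous d)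
    (c : ℂ) (x : Fin n → ℂ) : eval (c • x) f = c ^ d * eval x f := by
  rw [eval_eq, eval_eq, Finset.mul_sum]
  apply Finset.sum_congr rfl
  intro m hm
  have h := hf.degree_eq_sum_deg_support hm
  simp only [Pi.smul_apply, smul_eq_mul, mul_pow, Finset.prod_mul_distrib, Finset.prod_pow_eq_pow_sum]
  have : ∑ i ∈ m.support, m i = d := h.symm
  rw [this]; ring

/-- `d+1` distinct zeros on a line force vanishing on the span. -/
theorem vanish_line {d : ℕ} {ι : Type*} (s : Finset ι) (p : ι → Fin 3 → ℂ) (e f : Fin 3 → ℂ)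
    (a b : ι → ℂ) (hp : ∀ i ∈ s, p i = a i • e + b i • f)
    (hnp : ∀ i ∈ s, ∀ j ∈ s, i ≠ j → a i * b j - a j * b i ≠ 0) (hab : ∀ i ∈ s, a i ≠ 0 ∨ b i ≠ 0)
    (g : MvPolynomial (Fin 3) ℂ) (hg : g.IsHomogeneous d) (hs : d < s.card)
    (hv : ∀ i ∈ s, eval (p i) g = 0) (α β : ℂ) : eval (α • e + β • f) g = 0 := by
  let G : MvPolynomial (Fin 2) ℂ := aeval (fun k => C (e k) * X 0 + C (f k) * X 1) g
  have hG : G.IsHomogeneous d := by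
    have := hg.aeval (fun k => (C (e k) * X 0 + C (f k) * X 1 : MvPolynomial (Fin 2) ℂ)) (n := 1)
      (fun k => (isHomogeneous_C_mul_X _ _).add (isHomogeneous_C_mul_X _ _))
    rwa [one_mul] at this
  have key : ∀ x : Fin 2 → ℂ, eval x G = eval (x 0 • e + x 1 • f) g := by
    intro x
    have : ((aeval x : MvPolynomial (Fin 2) ℂ →ₐ[ℂ] ℂ).comp
        (aeval (fun k => C (e k) * X 0 + C (f k) * X 1))) =
      aeval (x 0 • e + x 1 • f) := by
      apply MvPolynomial.algHom_ext; intro i; simp; ring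
    have := DFunLike.congr_fun this g
    rw [AlgHom.comp_apply] at this
    rw [← coe_aeval_eq_eval, ← coe_aeval_eq_eval]
    exact this
  have hG0 : G = 0 := by
    by_contra h0
    have := (eq_C_mul_prod s (fun i => ![b i, - a i]) ?_ ?_ G hG h0 ?_).1
    · omega
    · intro i hi j hj hij c hc
      have h1 := congrFun hc 0
      have h2 := congrFun hc 1
      simp at h1 h2
      apply hnp i hi j hj hij
      rw [h1]; linear_combination (-b i) * h2
    · intro i hi h
      have h1 := congrFun h 0
      have h2 := congrFun h 1
      simp at h1 h2
      have := hab i hi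
      tauto
    · intro i hi x hx
      simp [Fin.sum_univ_two] at hx
      have hvi := hv i hi
      obtain ⟨c, hc0, hc1⟩ : ∃ c, x 0 = c * a i ∧ x 1 = c * b i := by
        rcases hab i hi with h | h
        · refine ⟨x 0 / a i, by field_simp, ?_⟩
          field_simp; linear_combination -hx
        · refine ⟨x 1 / b i, ?_, by field_simp⟩
          field_simp; linear_combination hx
      rw [key]
      have : x 0 • e + x 1 • f = c • p i := by
        rw [hp i hi, hc0, hc1, smul_add, smul_smul, smul_smul]
      rw [this, hom_eval_smul hg, hvi, mul_zero]
  have := key ![α, β]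
  rw [hG0] at this
  simpa using this.symm

theorem hom_one_eq_lf {f : MvPolynomial (Fin 3) ℂ} (hf : f.IsHomogeneous 1) :
    ∃ u, f = lf u := by
  have h := hf.sum_X_mul_pderiv
  have h2 : ∀ i, pderiv i f = C (coeff 0 (pderiv i f)) := by
    intro i
    rw [← totalDegree_eq_zero_iff_eq_C]
    have := (hf.pderiv (i := i)).totalDegree_le
    omega
  refine ⟨fun i => coeff 0 (pderiv i f), ?_⟩
  rw [one_smul] at h
  rw [← h, lf]
  apply Finset.sum_congr rfl
  intro i _
  rw [h]
  conv_lhs => rw [h2 i]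
  ring

theorem quot_hom {u : Fin 3 → ℂ} {a g : MvPolynomial (Fin 3) ℂ} (hg : g.IsHomogeneous 3)
    (h : g = lf u * a) : ∃ a', a'.IsHomogeneous 2 ∧ g = lf u * a' := by
  let _ := MvPolynomial.gradedAlgebra (R := ℂ) (σ := Fin 3)
  have h1 := DirectSum.coe_decompose_mul_of_left_mem_of_le (homogeneousSubmodule (Fin 3) ℂ)
    (a := lf u) (b := a) (i := 1) (n := 3) (lf_hom u) (by norm_num)
  rw [← h, DirectSum.decompose_of_mem_same _ hg] at h1
  exact ⟨(DirectSum.decompose (homogeneousSubmodule (Fin 3) ℂ) a (3 - 1) : MvPolynomial (Fin 3) ℂ), (DirectSum.decompose (homogeneousSubmodule (Fin 3) ℂ) a (3 - 1)).2, h1⟩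

def cr (u v : Fin 3 → ℂ) : Fin 3 → ℂ :=
  ![u 1 * v 2 - u 2 * v 1, u 2 * v 0 - u 0 * v 2, u 0 * v 1 - u 1 * v 0]

def dt (u v : Fin 3 → ℂ) : ℂ := u 0 * v 0 + u 1 * v 1 + u 2 * v 2

theorem sum_dt (u v : Fin 3 → ℂ) : ∑ i, u i * v i = dt u v := by
  simp [Fin.sum_univ_three, dt]

def d3 (u v w : Fin 3 → ℂ) : ℂ := dt u (cr v w)

theorem vanish_line' {d : ℕ} {ι : Type*} (s : Finset ι) (u : Fin 3 → ℂ) (v : ι → Fin 3 → ℂ)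
    (hnp : ∀ i ∈ s, ∀ j ∈ s, i ≠ j → d3 u (v i) (v j) ≠ 0)
    (g : MvPolynomial (Fin 3) ℂ) (hg : g.IsHomogeneous d) (hd : 1 ≤ d) (hs : d < s.card)
    (hv : ∀ i ∈ s, eval (cr u (v i)) g = 0) (x : Fin 3 → ℂ) (hx : dt u x = 0) :
    eval x g = 0 := by
  obtain ⟨i1, h1, i2, h2, h12⟩ := Finset.one_lt_card.1 (by omega : 1 < s.card)
  have hD := hnp i1 h1 i2 h2 h12
  set D := d3 u (v i1) (v i2) with hDd
  have key := vanish_line s (fun i => cr u (v i)) (cr u (v i1)) (cr u (v i2))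
    (fun i => d3 u (v i) (v i2) / D) (fun i => d3 u (v i1) (v i) / D) ?_ ?_ ?_ g hg hs hv
    (dt (v i2) x / D) (- (dt (v i1) x) / D)
  · have : x = (dt (v i2) x / D) • cr u (v i1) + (- (dt (v i1) x) / D) • cr u (v i2) := by
      have e : D • x = (dt (v i2) x) • cr u (v i1) + (- (dt (v i1) x)) • cr u (v i2) := by
        simp only [dt] at hx
        funext k
        fin_cases k
        · simp [hDd, d3, dt, cr]
          linear_combination (v i1 1 * v i2 2 - v i1 2 * v i2 1) * hx
        · simp [hDd, d3, dt, cr]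
          linear_combination (v i1 2 * v i2 0 - v i1 0 * v i2 2) * hx
        · simp [hDd, d3, dt, cr]
          linear_combination (v i1 0 * v i2 1 - v i1 1 * v i2 0) * hx
      have e2 := congrArg (fun y => D⁻¹ • y) e
      simp only [smul_add, smul_smul, inv_mul_cancel₀ hD, one_smul] at e2
      refine e2.trans ?_; congr 2 <;> field_simp
    rw [this]; exact key
  · intro i hi
    have e : D • cr u (v i) = (d3 u (v i) (v i2)) • cr u (v i1) + (d3 u (v i1) (v i)) • cr u (v i2) := by
      funext k
      fin_cases k <;> simp [hDd, d3, dt, cr] <;> ring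
    have e2 := congrArg (fun y => D⁻¹ • y) e
    simp only [smul_add, smul_smul, inv_mul_cancel₀ hD, one_smul] at e2
    rw [e2]; congr 2 <;> field_simp
  · intro i hi j hj hij
    have := hnp i hi j hj hij
    have e : d3 u (v i) (v i2) / D * (d3 u (v i1) (v j) / D) -
      d3 u (v j) (v i2) / D * (d3 u (v i1) (v i) / D) = d3 u (v i) (v j) / D := by
      field_simp
      simp [hDd, d3, dt, cr] ; ring
    rw [e]
    exact div_ne_zero this hD
  · intro i hi
    by_cases h : i1 = i
    · left; rw [← h]; exact div_ne_zero hD hD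
    · right; exact div_ne_zero (hnp i1 h1 i hi h) hD

def InvL (A B Cz : MvPolynomial (Fin 3) ℂ) (u : Fin 3 → ℂ) : Prop :=
  lf u ∣ C (u 0) * A + C (u 1) * B + C (u 2) * Cz

theorem Zop_lf (A B Cz : MvPolynomial (Fin 3) ℂ) (u : Fin 3 → ℂ) :
    Zop A B Cz (lf u) = C (u 0) * A + C (u 1) * B + C (u 2) * Cz := by
  simp [Zop, lf, Fin.sum_univ_three, pderiv_X]
  ring

theorem dt_of_inv {A B Cz : MvPolynomial (Fin 3) ℂ} {u x : Fin 3 → ℂ} (h : InvL A B Cz u)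
    (hx : dt u x = 0) : u 0 * eval x A + u 1 * eval x B + u 2 * eval x Cz = 0 := by
  have := eval_of_lf_dvd h (x := x) (by rw [sum_dt, hx])
  simpa using this

theorem not_par {A B Cz : MvPolynomial (Fin 3) ℂ} (hfol : IsFolDeg 3 (OmZ A B Cz))
    (u : Fin 3 → ℂ) (hu : u ≠ 0) (h : ∀ b x, dt u x = 0 → eval x (OmZ A B Cz b) = 0) : False := by
  have := hfol.2.2.2 (lf u) fun b => lf_dvd_of_vanish u hu _ fun x hx => h b x (by rwa [← sum_dt])
  exact (lf_irr u hu).not_isUnit this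

def pO (A B Cz : MvPolynomial (Fin 3) ℂ) (p : Fin 3 → ℂ) : MvPolynomial (Fin 3) ℂ :=
  C (p 0) * OmZ A B Cz 0 + C (p 1) * OmZ A B Cz 1 + C (p 2) * OmZ A B Cz 2

theorem pO_ne {A B Cz : MvPolynomial (Fin 3) ℂ} (hE : extactic A B Cz ≠ 0)
    (p : Fin 3 → ℂ) (hp : p ≠ 0) : pO A B Cz p ≠ 0 := by
  intro h
  have hZ : ∀ f g, Zop A B Cz (f * g) = f * Zop A B Cz g + g * Zop A B Cz f := by
    intro f g; simp [Zop, Derivation.leibniz]; ring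
  have hZa : ∀ f g, Zop A B Cz (f + g) = Zop A B Cz f + Zop A B Cz g := by
    intro f g; simp [Zop]; ring
  have hZs : ∀ f g, Zop A B Cz (f - g) = Zop A B Cz f - Zop A B Cz g := by
    intro f g; simp [Zop]; ring
  have hZC : ∀ c, Zop A B Cz (C c) = 0 := by
    intro c; simp [Zop]
  have hX0 : Zop A B Cz (X 0) = A := by simp [Zop, pderiv_X]
  have hX1 : Zop A B Cz (X 1) = B := by simp [Zop, pderiv_X]
  have hX2 : Zop A B Cz (X 2) = Cz := by simp [Zop, pderiv_X]
  have h2 : Zop A B Cz (pO A B Cz p) = 0 := by rw [h]; simp [Zop]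
  simp only [pO, OmZ, hZa, hZ, hZC, Matrix.cons_val_zero, Matrix.cons_val_one, Matrix.cons_val, hZs,
    hX0, hX1, hX2] at h2
  simp only [pO, OmZ, Matrix.cons_val_zero, Matrix.cons_val_one, Matrix.cons_val] at h
  have hEe : extactic A B Cz = X 0 * (B * Zop A B Cz Cz - Cz * Zop A B Cz B)
      - X 1 * (A * Zop A B Cz Cz - Cz * Zop A B Cz A)
      + X 2 * (A * Zop A B Cz B - B * Zop A B Cz A) := by
    rw [extactic, Matrix.det_fin_three]
    simp [hX0, hX1, hX2]; ring
  set E := extactic A B Cz with hEd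
  set A' := Zop A B Cz A
  set B' := Zop A B Cz B
  set C' := Zop A B Cz Cz
  have k : ∀ i, lf (cr p (Pi.single i 1)) * E = 0 := by
    intro i
    rw [hEe]
    fin_cases i
    · have : lf (cr p (Pi.single (0 : Fin 3) 1)) = C (p 2) * X 1 - C (p 1) * X 2 := by
        simp [lf, cr, Fin.sum_univ_three]; ring
      refine (congrArg (· * _) this).trans ?_
      linear_combination (X 1 * Cz - X 2 * B) * h2 - (X 1 * C' - X 2 * B') * h
    · have : lf (cr p (Pi.single (1 : Fin 3) 1)) = C (p 0) * X 2 - C (p 2) * X 0 := by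
        simp [lf, cr, Fin.sum_univ_three]; ring
      refine (congrArg (· * _) this).trans ?_
      linear_combination (X 2 * A - X 0 * Cz) * h2 - (X 2 * A' - X 0 * C') * h
    · have : lf (cr p (Pi.single (2 : Fin 3) 1)) = C (p 1) * X 0 - C (p 0) * X 1 := by
        simp [lf, cr, Fin.sum_univ_three]; ring
      refine (congrArg (· * _) this).trans ?_
      linear_combination (X 0 * B - X 1 * A) * h2 - (X 0 * B' - X 1 * A') * h
  have k2 : ∀ i, cr p (Pi.single i 1) = 0 := by
    intro i
    by_contra hc
    rcases mul_eq_zero.1 (k i) with h | h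
    · exact lf_ne _ hc h
    · exact hE h
  apply hp
  have a0 := k2 0
  have a1 := k2 1
  funext i
  fin_cases i
  · have := congrFun a1 2; simpa [cr] using this
  · have := congrFun a0 2; simpa [cr] using this
  · have := congrFun a0 1; simpa [cr] using this

theorem pO_vanish {A B Cz : MvPolynomial (Fin 3) ℂ} {v p x : Fin 3 → ℂ} (hv : v ≠ 0)
    (h : InvL A B Cz v) (hp : dt v p = 0) (hx : dt v x = 0) : eval x (pO A B Cz p) = 0 := by
  have hF := dt_of_inv h hx
  simp only [dt] at hp hx
  obtain ⟨i, hi⟩ : ∃ i, v i ≠ 0 := by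
    by_contra hc; push Not at hc; exact hv (funext hc)
  apply mul_left_cancel₀ hi
  rw [mul_zero]
  simp only [pO, OmZ, Matrix.cons_val_zero, Matrix.cons_val_one, Matrix.cons_val, map_add, map_mul, map_sub, eval_C, eval_X]
  generalize eval x A = a at *
  generalize eval x B = b at *
  generalize eval x Cz = c at *
  fin_cases i
  · simp only [Fin.zero_eta]
    linear_combination (x 2 * b - x 1 * c) * hp + (p 1 * c - p 2 * b) * hx + (p 2 * x 1 - p 1 * x 2) * hF
  · simp only [Fin.mk_one]
    linear_combination (x 0 * c - x 2 * a) * hp + (p 2 * a - p 0 * c) * hx + (p 0 * x 2 - p 2 * x 0) * hF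
  · simp only [Fin.reduceFinMk]
    linear_combination (x 1 * a - x 0 * b) * hp + (p 0 * b - p 1 * a) * hx + (p 1 * x 0 - p 0 * x 1) * hF

theorem Om_cr {A B Cz : MvPolynomial (Fin 3) ℂ} {u v : Fin 3 → ℂ} (hu : InvL A B Cz u)
    (hv : InvL A B Cz v) (b : Fin 3) : eval (cr u v) (OmZ A B Cz b) = 0 := by
  have h1 := dt_of_inv hu (x := cr u v) (by simp [dt, cr]; ring)
  have h2 := dt_of_inv hv (x := cr u v) (by simp [dt, cr]; ring)
  have e : eval (cr u v) (OmZ A B Cz b) = ![cr u v 2 * eval (cr u v) B - cr u v 1 * eval (cr u v) Cz,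
    cr u v 0 * eval (cr u v) Cz - cr u v 2 * eval (cr u v) A,
    cr u v 1 * eval (cr u v) A - cr u v 0 * eval (cr u v) B] b := by
    fin_cases b <;> simp [OmZ]
  rw [e]
  generalize eval (cr u v) A = a at *
  generalize eval (cr u v) B = b' at *
  generalize eval (cr u v) Cz = c at *
  fin_cases b <;> simp [cr]
  · linear_combination u 0 * h2 - v 0 * h1
  · linear_combination u 1 * h2 - v 1 * h1
  · linear_combination u 2 * h2 - v 2 * h1

theorem T2 {A B Cz : MvPolynomial (Fin 3) ℂ} (hfol : IsFolDeg 3 (OmZ A B Cz)) {ι : Type*}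
    (s : Finset ι) (u : Fin 3 → ℂ) (v : ι → Fin 3 → ℂ) (hu0 : u ≠ 0) (hu : InvL A B Cz u)
    (hv : ∀ i ∈ s, InvL A B Cz (v i))
    (hnp : ∀ i ∈ s, ∀ j ∈ s, i ≠ j → d3 u (v i) (v j) ≠ 0) : s.card ≤ 4 := by
  by_contra hc
  apply not_par hfol u hu0
  intro b x hx
  exact vanish_line' s u v hnp _ (hfol.2.1 b) (by norm_num) (by omega)
    (fun i hi => Om_cr hu (hv i hi) b) x hx

theorem par_of_orth {u v a : Fin 3 → ℂ} (h1 : dt u a = 0) (h2 : dt v a = 0) (b c : Fin 3) :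
    cr u v b * a c - cr u v c * a b = 0 := by
  simp only [dt] at h1 h2
  fin_cases b <;> fin_cases c <;> simp [cr]
  · linear_combination -u 2 * h2 + v 2 * h1
  · linear_combination u 1 * h2 - v 1 * h1
  · linear_combination u 2 * h2 - v 2 * h1
  · linear_combination -u 0 * h2 + v 0 * h1
  · linear_combination -u 1 * h2 + v 1 * h1
  · linear_combination u 0 * h2 - v 0 * h1

theorem cr_rel (u v w : Fin 3 → ℂ) (h : d3 u v w = 0) (m : Fin 3) :
    cr u v m • w = cr u w m • v + cr w v m • u := by
  simp only [d3, dt, cr, Matrix.cons_val_zero, Matrix.cons_val_one, Matrix.cons_val] at h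
  funext k
  fin_cases m <;> fin_cases k <;> simp [cr]
  · linear_combination h
  · ring
  · ring
  · ring
  · linear_combination h
  · ring
  · ring
  · ring
  · linear_combination h

theorem exists_coord_ne {u : Fin 3 → ℂ} (hu : u ≠ 0) : ∃ m, u m ≠ 0 := by
  by_contra hc; push Not at hc; exact hu (funext hc)

theorem cr_smul_self (c : ℂ) (u : Fin 3 → ℂ) : cr u (c • u) = 0 := by
  funext k; fin_cases k <;> simp [cr] <;> ring

theorem cr_zero (u : Fin 3 → ℂ) : cr u 0 = 0 := by
  funext k; fin_cases k <;> simp [cr]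

theorem T3 {A B Cz : MvPolynomial (Fin 3) ℂ}
    (hA : A.IsHomogeneous 3) (hB : B.IsHomogeneous 3) (hC : Cz.IsHomogeneous 3)
    (hfol : IsFolDeg 3 (OmZ A B Cz)) {ι : Type*}
    (s : Finset ι) (u : Fin 3 → ℂ) (v w : ι → Fin 3 → ℂ) (hu0 : u ≠ 0) (hu : InvL A B Cz u)
    (hv : ∀ i ∈ s, InvL A B Cz (v i)) (hw : ∀ i ∈ s, InvL A B Cz (w i))
    (hnp : ∀ i ∈ s, ∀ j ∈ s, i ≠ j → d3 u (v i) (v j) ≠ 0) (hs : 3 < s.card)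
    (hco : ∀ i ∈ s, d3 u (v i) (w i) = 0)
    (huv : ∀ i ∈ s, cr u (v i) ≠ 0) (huw : ∀ i ∈ s, cr u (w i) ≠ 0)
    (hvw : ∀ i ∈ s, cr (w i) (v i) ≠ 0) : False := by
  obtain ⟨a0, ha0⟩ := hu
  obtain ⟨a, ha2, ha⟩ := quot_hom (((hA.C_mul _).add (hB.C_mul _)).add (hC.C_mul _)) ha0
  clear ha0 a0
  set F : Fin 3 → MvPolynomial (Fin 3) ℂ := ![A, B, Cz] with hF
  have hFh : ∀ b, (F b).IsHomogeneous 3 := by intro b; fin_cases b <;> simpa [hF]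
  set G : Fin 3 → MvPolynomial (Fin 3) ℂ := fun b => F b - X b * a with hG
  have hGh : ∀ b, (G b).IsHomogeneous 3 := by
    intro b; exact (hFh b).sub ((isHomogeneous_X ℂ b).mul ha2)
  have hdG : ∀ v' : Fin 3 → ℂ, C (v' 0) * G 0 + C (v' 1) * G 1 + C (v' 2) * G 2
      = C (v' 0) * A + C (v' 1) * B + C (v' 2) * Cz - lf v' * a := by
    intro v'; simp [hG, hF, lf, Fin.sum_univ_three]; ring
  have huG : C (u 0) * G 0 + C (u 1) * G 1 + C (u 2) * G 2 = 0 := by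
    rw [hdG, ha, sub_self]
  have hvG : ∀ v', InvL A B Cz v' → ∃ c, C (v' 0) * G 0 + C (v' 1) * G 1 + C (v' 2) * G 2 = lf v' * c := by
    rintro v' ⟨c, hc⟩
    exact ⟨c - a, by rw [hdG, hc]; ring⟩
  have hvan : ∀ k b b' x, dt u x = 0 →
      eval x (X b * pderiv k (G b') - X b' * pderiv k (G b)) = 0 := by
    intro k b b' x hx
    refine vanish_line' (d := 3) s u v hnp _ ?_ (by norm_num) hs ?_ x hx
    · exact ((isHomogeneous_X ℂ b).mul (hGh b').pderiv).sub ((isHomogeneous_X ℂ b').mul (hGh b).pderiv)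
    · intro i hi
      simp only [map_sub, map_mul, eval_X]
      refine par_of_orth (u := u) (v := v i) (a := fun b => eval (cr u (v i)) (pderiv k (G b))) ?_ ?_ b b'
      · have := congrArg (fun q => eval (cr u (v i)) (pderiv k q)) huG
        simpa [dt] using this
      · obtain ⟨c, hc⟩ := hvG _ (hv i hi)
        obtain ⟨c', hc'⟩ := hvG _ (hw i hi)
        have hc0 : eval (cr u (v i)) c = 0 := by
          obtain ⟨m, hm⟩ := exists_coord_ne (huv i hi)
          have hrel := cr_rel _ _ _ (hco i hi) m
          have hal : cr u (w i) m ≠ 0 := by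
            intro h0
            rw [h0, zero_smul, zero_add] at hrel
            apply huw i hi
            have : w i = ((cr u (v i) m)⁻¹ * cr (w i) (v i) m) • u := by
              rw [mul_smul, ← hrel, smul_smul, inv_mul_cancel₀ hm, one_smul]
            rw [this, cr_smul_self]
          have hw0 : w i ≠ 0 := by
            intro h0; apply huw i hi; rw [h0, cr_zero]
          have hv0 : v i ≠ 0 := by
            intro h0; apply huv i hi; rw [h0, cr_zero]
          have e : C (cr u (w i) m) * (lf (v i) * c) = C (cr u (v i) m) * (lf (w i) * c') := by
            rw [← hc, ← hc']
            have r0 := congrArg (C (σ := Fin 3)) (congrFun hrel 0)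
            have r1 := congrArg (C (σ := Fin 3)) (congrFun hrel 1)
            have r2 := congrArg (C (σ := Fin 3)) (congrFun hrel 2)
            simp only [Pi.smul_apply, Pi.add_apply, smul_eq_mul, map_mul, map_add] at r0 r1 r2
            linear_combination -(r0 * G 0 + r1 * G 1 + r2 * G 2) - C (cr (w i) (v i) m) * huG
          have e2 : lf (v i) * c = lf (w i) * (C ((cr u (w i) m)⁻¹ * cr u (v i) m) * c') := by
            have : (C (cr u (w i) m)⁻¹ : MvPolynomial (Fin 3) ℂ) * C (cr u (w i) m) = 1 := by
              rw [← C_mul, inv_mul_cancel₀ hal, C_1]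
            rw [C_mul]
            linear_combination C (cr u (w i) m)⁻¹ * e - lf (v i) * c * this
          have hd : lf (w i) ∣ c := by
            rcases (lf_prime _ hw0).dvd_or_dvd ⟨_, e2⟩ with h | h
            · exfalso
              obtain ⟨r, hr⟩ := lf_dvd_lf hv0 h
              apply hvw i hi
              rw [hr, cr_smul_self]
            · exact h
          apply eval_of_lf_dvd hd
          rw [sum_dt]
          have := hco i hi
          simp [d3, dt, cr] at this ⊢
          linear_combination this
        have := congrArg (fun q => eval (cr u (v i)) (pderiv k q)) hc
        simp only [Derivation.leibniz, smul_eq_mul, map_add, map_mul, hc0, eval_lf, sum_dt] at this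
        have e0 : dt (v i) (cr u (v i)) = 0 := by simp [dt, cr]; ring
        simp [e0] at this
        simpa [dt] using this
  apply not_par hfol u hu0
  have hfin : ∀ b b' x, dt u x = 0 → eval x (X b * F b' - X b' * F b) = 0 := by
    intro b b' x hx
    have h0 := hvan 0 b b' x hx
    have h1 := hvan 1 b b' x hx
    have h2 := hvan 2 b b' x hx
    have e1 := congrArg (eval x) (hGh b').sum_X_mul_pderiv
    have e2 := congrArg (eval x) (hGh b).sum_X_mul_pderiv
    simp [Fin.sum_univ_three] at e1 e2
    simp only [map_sub, map_mul, eval_X] at h0 h1 h2 ⊢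
    have g1 : eval x (G b) = eval x (F b) - x b * eval x a := by simp [hG]
    have g2 : eval x (G b') = eval x (F b') - x b' * eval x a := by simp [hG]
    linear_combination (x 0 * h0 + x 1 * h1 + x 2 * h2 - x b * e1 + x b' * e2) / 3 - x b * g2 + x b' * g1
  intro b x hx
  fin_cases b
  · exact hfin 2 1 x hx
  · exact hfin 0 2 x hx
  · exact hfin 1 0 x hx

/-- two covectors both orthogonal to `p`, nonproportional: `p` is their cross product -/
theorem eq_smul_cr {u v p : Fin 3 → ℂ} (h1 : dt u p = 0) (h2 : dt v p = 0) (hn : cr u v ≠ 0) :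
    ∃ c : ℂ, p = c • cr u v := by
  obtain ⟨m, hm⟩ := exists_coord_ne hn
  refine ⟨p m / cr u v m, ?_⟩
  funext k
  have := par_of_orth h1 h2 m k
  simp only [Pi.smul_apply, smul_eq_mul]
  field_simp
  linear_combination this

theorem not_smul_of_cr {u v : Fin 3 → ℂ} (h : cr u v ≠ 0) (c : ℂ) : v ≠ c • u := by
  rintro rfl; exact h (cr_smul_self _ _)

theorem pO_hom {A B Cz : MvPolynomial (Fin 3) ℂ} (hfol : IsFolDeg 3 (OmZ A B Cz)) (p : Fin 3 → ℂ) :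
    (pO A B Cz p).IsHomogeneous 4 :=
  (((hfol.2.1 0).C_mul _).add ((hfol.2.1 1).C_mul _)).add ((hfol.2.1 2).C_mul _)

theorem T1 {A B Cz : MvPolynomial (Fin 3) ℂ} (hfol : IsFolDeg 3 (OmZ A B Cz))
    (hE : extactic A B Cz ≠ 0) {ι : Type*}
    (s : Finset ι) (u : ι → Fin 3 → ℂ) (hu : ∀ i, InvL A B Cz (u i)) (h0 : ∀ i, u i ≠ 0)
    (hnp : ∀ i j, i ≠ j → cr (u i) (u j) ≠ 0)
    (p : Fin 3 → ℂ) (hp0 : p ≠ 0) (hp : ∀ i ∈ s, dt (u i) p = 0) :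
    s.card ≤ 4 ∧ (s.card = 4 → ∃ k : ℂ, k ≠ 0 ∧ pO A B Cz p = C k * ∏ i ∈ s, lf (u i)) :=
  eq_C_mul_prod s u (fun i _ j _ hij c => not_smul_of_cr (hnp i j hij) c) (fun i _ => h0 i) _
    (pO_hom hfol p) (pO_ne hE p hp0) fun i hi x hx =>
      pO_vanish (h0 i) (hu i) (hp i hi) (by rwa [← sum_dt])

theorem d3_eq (u v w : Fin 3 → ℂ) : d3 u v w = dt w (cr u v) := by
  simp [d3, dt, cr]; ring

theorem dt_smul (u p : Fin 3 → ℂ) (c : ℂ) : dt u (c • p) = c * dt u p := by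
  simp [dt]; ring

open Classical in
def inc (u : Fin 9 → Fin 3 → ℂ) (p : Fin 3 → ℂ) : Finset (Fin 9) :=
  Finset.univ.filter fun k => dt (u k) p = 0

theorem mem_inc {u : Fin 9 → Fin 3 → ℂ} {p : Fin 3 → ℂ} {k : Fin 9} :
    k ∈ inc u p ↔ dt (u k) p = 0 := by simp [inc]

theorem inc_eq {u : Fin 9 → Fin 3 → ℂ} (hnp : ∀ i j, i ≠ j → cr (u i) (u j) ≠ 0)
    {p q : Fin 3 → ℂ} (hp : p ≠ 0) (hq : q ≠ 0) {i j : Fin 9} (hij : i ≠ j)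
    (h1 : i ∈ inc u p) (h2 : j ∈ inc u p) (h3 : i ∈ inc u q) (h4 : j ∈ inc u q) :
    inc u p = inc u q := by
  rw [mem_inc] at h1 h2 h3 h4
  obtain ⟨c, hc⟩ := eq_smul_cr h1 h2 (hnp i j hij)
  obtain ⟨d, hd⟩ := eq_smul_cr h3 h4 (hnp i j hij)
  have hc0 : c ≠ 0 := by rintro rfl; simp [hc] at hp
  have hd0 : d ≠ 0 := by rintro rfl; simp [hd] at hq
  ext k
  rw [mem_inc, mem_inc, hc, hd, dt_smul, dt_smul]
  simp [hc0, hd0]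

theorem four_point {A B Cz : MvPolynomial (Fin 3) ℂ}
    (hA : A.IsHomogeneous 3) (hB : B.IsHomogeneous 3) (hC : Cz.IsHomogeneous 3)
    (hfol : IsFolDeg 3 (OmZ A B Cz)) (hE : extactic A B Cz ≠ 0)
    (u : Fin 9 → Fin 3 → ℂ) (hu : ∀ i, InvL A B Cz (u i)) (h0 : ∀ i, u i ≠ 0)
    (hnp : ∀ i j, i ≠ j → cr (u i) (u j) ≠ 0) (i : Fin 9) :
    ∃ p, p ≠ 0 ∧ i ∈ inc u p ∧ (inc u p).card = 4 := by
  by_contra hcon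
  push Not at hcon
  set S : Finset (Fin 9) := Finset.univ.erase i with hS
  have hScard : S.card = 8 := by simp [hS]
  set f : Fin 9 → Finset (Fin 9) := fun j => inc u (cr (u i) (u j)) with hf
  have hi : ∀ j, i ∈ f j := by
    intro j; rw [hf, mem_inc]; simp [dt, cr]; ring
  have hj : ∀ j, j ∈ f j := by
    intro j; rw [hf, mem_inc]; simp [dt, cr]; ring
  have hSi : ∀ j ∈ S, i ≠ j := by
    intro j hj h; simp [hS, h] at hj
  have hcard : ∀ j ∈ S, (f j).card ≤ 3 := by
    intro j hjS
    have hn := hnp i j (hSi j hjS)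
    have h1 := (T1 hfol hE (f j) u hu h0 hnp (cr (u i) (u j)) hn
      (fun k hk => mem_inc.1 hk)).1
    have h2 := hcon _ hn (hi j)
    have : (f j).card ≠ 4 := h2
    omega
  have hfib : ∀ b ∈ S.image f, (S.filter fun k => f k = b).card ≤ 2 := by
    intro b hb
    obtain ⟨j, hjS, rfl⟩ := Finset.mem_image.1 hb
    have hsub : (S.filter fun k => f k = f j) ⊆ (f j).erase i := by
      intro k hk
      rw [Finset.mem_filter] at hk
      rw [Finset.mem_erase]
      exact ⟨(hSi k hk.1).symm, hk.2 ▸ hj k⟩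
    have := Finset.card_le_card hsub
    rw [Finset.card_erase_of_mem (hi j)] at this
    have := hcard j hjS
    omega
  have hd3 : ∀ j ∈ S, ∀ k ∈ S, d3 (u i) (u j) (u k) = 0 ↔ f j = f k := by
    intro j hjS k hkS
    rw [d3_eq]
    constructor
    · intro h
      exact inc_eq hnp (hnp i j (hSi j hjS)) (hnp i k (hSi k hkS)) (hSi k hkS) (hi j)
        (mem_inc.2 h) (hi k) (hj k)
    · intro h
      have := hj k
      rw [← h] at this
      exact mem_inc.1 this
  obtain ⟨T, hTS, hTinj, hTim⟩ := Finset.exists_subset_injOn_image_eq_of_surjOn (f := f) (S : Set (Fin 9))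
    (S.image f) (by intro b hb; simpa using hb)
  have hTS' : ∀ j ∈ T, j ∈ S := fun j hj => by simpa using hTS hj
  have hTcard : T.card = (S.image f).card := by
    rw [← hTim, Finset.card_image_of_injOn hTinj]
  have hne : ∀ j ∈ T, ∀ k ∈ T, j ≠ k → d3 (u i) (u j) (u k) ≠ 0 := by
    intro j hjT k hkT hjk h
    rw [hd3 j (hTS' j hjT) k (hTS' k hkT)] at h
    exact hjk (hTinj hjT hkT h)
  have hT4 := T2 hfol T (u i) u (h0 i) (hu i) (fun j _ => hu j) hne
  have hsum := Finset.card_eq_sum_card_image f S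
  have hle : ∑ b ∈ S.image f, (S.filter fun k => f k = b).card ≤ ∑ b ∈ S.image f, 2 :=
    Finset.sum_le_sum hfib
  have hw : ∀ j, ∃ k, j ∈ T → k ∈ S ∧ k ≠ j ∧ f k = f j := by
    intro j
    by_contra hc
    push Not at hc
    have hjT := (hc j).1
    have hlt : ∑ b ∈ S.image f, (S.filter fun k => f k = b).card < ∑ b ∈ S.image f, 2 := by
      apply Finset.sum_lt_sum hfib
      refine ⟨f j, Finset.mem_image_of_mem f (hTS' j hjT), ?_⟩
      have : (S.filter fun k => f k = f j) ⊆ {j} := by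
        intro k hk
        rw [Finset.mem_filter] at hk
        rw [Finset.mem_singleton]
        by_contra hkj
        exact (hc k).2 hk.1 hkj hk.2
      have := Finset.card_le_card this
      simp at this
      omega
    simp at hlt
    omega
  choose w hw using hw
  simp at hle
  refine T3 hA hB hC hfol T (u i) u (fun j => u (w j)) (h0 i) (hu i) (fun j _ => hu j)
    (fun j _ => hu _) hne (by omega) ?_ ?_ ?_ ?_
  · intro j hj
    obtain ⟨a, b, c⟩ := hw j hj
    rw [hd3 j (hTS' j hj) _ a, c]
  · intro j hj
    exact hnp _ _ (hSi j (hTS' j hj))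
  · intro j hj
    exact hnp _ _ (hSi _ (hw j hj).1)
  · intro j hj
    exact hnp _ _ (hw j hj).2.1

theorem combi (𝓕 : Set (Finset (Fin 9))) (h4 : ∀ P ∈ 𝓕, P.card = 4)
    (hint : ∀ P ∈ 𝓕, ∀ Q ∈ 𝓕, P ≠ Q → (P ∩ Q).card ≤ 1) (hcov : ∀ i, ∃ P ∈ 𝓕, i ∈ P) :
    ∃ P ∈ 𝓕, ∃ Q ∈ 𝓕, ∃ R ∈ 𝓕, ∃ i j k, i ∈ P ∧ i ∈ Q ∧ j ∈ Q ∧ j ∈ R ∧ k ∈ R ∧ k ∈ P ∧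
      i ≠ j ∧ j ≠ k ∧ i ≠ k ∧ P ≠ Q ∧ Q ≠ R ∧ P ≠ R := by
  obtain ⟨P, hP, -⟩ := hcov 0
  have hP4 := h4 P hP
  have hex : ∀ U : Finset (Fin 9), U.card < 9 → ∃ m, m ∉ U := by
    intro U hU
    by_contra hc
    push Not at hc
    have : U = Finset.univ := Finset.eq_univ_iff_forall.2 hc
    simp [this] at hU
  obtain ⟨m, hm⟩ := hex P (by omega)
  obtain ⟨Q, hQ, hmQ⟩ := hcov m
  have hQ4 := h4 Q hQ
  have hPQ : P ≠ Q := by rintro rfl; exact hm hmQ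
  have hc := Finset.card_union_add_card_inter P Q
  obtain ⟨n, hn⟩ := hex (P ∪ Q) (by omega)
  obtain ⟨R, hR, hnR⟩ := hcov n
  have hR4 := h4 R hR
  rw [Finset.mem_union, not_or] at hn
  have hPR : P ≠ R := by rintro rfl; exact hn.1 hnR
  have hQR : Q ≠ R := by rintro rfl; exact hn.2 hnR
  have i1 := hint P hP Q hQ hPQ
  have i2 := hint Q hQ R hR hQR
  have i3 := hint P hP R hR hPR
  have c1 := Finset.card_sdiff_add_card_inter R (P ∪ Q)
  have c2 : (R \ (P ∪ Q)).card ≤ (Finset.univ \ (P ∪ Q)).card :=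
    Finset.card_le_card (Finset.sdiff_subset_sdiff (Finset.subset_univ R) (Finset.Subset.refl (P ∪ Q)))
  have c3 : (Finset.univ \ (P ∪ Q)).card + (P ∪ Q).card = 9 := by
    have := Finset.card_sdiff_add_card_eq_card (Finset.subset_univ (P ∪ Q))
    rw [this]
    exact Finset.card_fin 9
  have c4 := Finset.card_union_add_card_inter (P ∩ R) (Q ∩ R)
  have c5 : R ∩ (P ∪ Q) = (P ∩ R) ∪ (Q ∩ R) := by
    rw [Finset.inter_union_distrib_left, Finset.inter_comm R P, Finset.inter_comm R Q]
  rw [c5] at c1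
  have e1 : (P ∩ Q).card = 1 := by omega
  have e2 : (Q ∩ R).card = 1 := by omega
  have e3 : (P ∩ R).card = 1 := by omega
  have e4 : ((P ∩ R) ∩ (Q ∩ R)).card = 0 := by omega
  rw [Finset.card_eq_zero] at e4
  have hno : ∀ x, x ∈ P → x ∈ Q → x ∈ R → False := by
    intro x a b c
    have : x ∈ (P ∩ R) ∩ (Q ∩ R) := by simp [a, b, c]
    rw [e4] at this; simp at this
  obtain ⟨i, hi⟩ := Finset.card_pos.1 (by omega : 0 < (P ∩ Q).card)
  obtain ⟨j, hj⟩ := Finset.card_pos.1 (by omega : 0 < (Q ∩ R).card)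
  obtain ⟨k, hk⟩ := Finset.card_pos.1 (by omega : 0 < (P ∩ R).card)
  rw [Finset.mem_inter] at hi hj hk
  refine ⟨P, hP, Q, hQ, R, hR, i, j, k, hi.1, hi.2, hj.1, hj.2, hk.2, hk.1, ?_, ?_, ?_, hPQ, hQR, hPR⟩
  · rintro rfl; exact hno _ hi.1 hi.2 hj.2
  · rintro rfl; exact hno _ hk.1 hj.1 hk.2
  · rintro rfl; exact hno _ hi.1 hi.2 hk.2

theorem W_form (P : Finset (Fin 9)) (nu : Fin 9 → Fin 3 → ℂ) (x y : Fin 3) (i k : Fin 9)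
    (hi : i ∈ P) (hk : k ∈ P) (hik : i ≠ k) (hP : P.card = 4)
    (hlf : ∀ t ∈ P, lf (nu t) = C (nu t x) * X x + C (nu t y) * X y)
    (hix : nu i x = 0) (hky : nu k y = 0)
    (hx : ∀ t ∈ P, t ≠ i → nu t x ≠ 0) (hy : ∀ t ∈ P, t ≠ k → nu t y ≠ 0) :
    ∃ a b c : ℂ, a ≠ 0 ∧ c ≠ 0 ∧ ∏ t ∈ P, lf (nu t) =
      X x * X y * (C a * X x ^ 2 + C b * X x * X y + C c * X y ^ 2) := by
  have hk' : k ∈ P.erase i := by simp [hk, hik.symm]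
  have h2 : ((P.erase i).erase k).card = 2 := by
    rw [Finset.card_erase_of_mem hk', Finset.card_erase_of_mem hi]; omega
  obtain ⟨s, t, hst, hS⟩ := Finset.card_eq_two.1 h2
  have hs : s ∈ (P.erase i).erase k := by simp [hS]
  have ht : t ∈ (P.erase i).erase k := by simp [hS]
  simp only [Finset.mem_erase] at hs ht
  refine ⟨nu i y * nu k x * (nu s x * nu t x), nu i y * nu k x * (nu s x * nu t y + nu s y * nu t x),
    nu i y * nu k x * (nu s y * nu t y), ?_, ?_, ?_⟩
  · have a1 := hy i hi hik
    have a2 := hx k hk hik.symm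
    have a3 := hx s hs.2.2 hs.2.1
    have a4 := hx t ht.2.2 ht.2.1
    positivity
  · have a1 := hy i hi hik
    have a2 := hx k hk hik.symm
    have a3 := hy s hs.2.2 hs.1
    have a4 := hy t ht.2.2 ht.1
    positivity
  · rw [← Finset.mul_prod_erase P _ hi, ← Finset.mul_prod_erase _ _ hk', hS, Finset.prod_pair hst,
      hlf i hi, hlf k hk, hlf s hs.2.2, hlf t ht.2.2, hix, hky]
    simp only [C_mul, C_add, C_0]
    ring

theorem subst3_lf (M : Matrix (Fin 3) (Fin 3) ℂ) (u : Fin 3 → ℂ) :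
    subst3 M (lf u) = lf (fun c => dt u (fun r => M r c)) := by
  simp [subst3, lf, dt, Fin.sum_univ_three]; ring

theorem pb3_eq (M : Matrix (Fin 3) (Fin 3) ℂ) (A B Cz : MvPolynomial (Fin 3) ℂ) (c : Fin 3) :
    pb3 M (OmZ A B Cz) c = subst3 M (pO A B Cz (fun r => M r c)) := by
  simp [pb3, subst3, pO, Fin.sum_univ_three]

theorem pb3_euler (M : Matrix (Fin 3) (Fin 3) ℂ) (A B Cz : MvPolynomial (Fin 3) ℂ) :
    X 0 * pb3 M (OmZ A B Cz) 0 + X 1 * pb3 M (OmZ A B Cz) 1 + X 2 * pb3 M (OmZ A B Cz) 2 = 0 := by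
  simp [pb3, subst3, OmZ, Fin.sum_univ_three]; ring

theorem pb3_scale (M : Matrix (Fin 3) (Fin 3) ℂ) (d : Fin 3 → ℂ)
    (Ω : Fin 3 → MvPolynomial (Fin 3) ℂ) (c : Fin 3) :
    pb3 (M * Matrix.diagonal d) Ω c =
      C (d c) * aeval (fun c => C (d c) * X c : Fin 3 → MvPolynomial (Fin 3) ℂ) (pb3 M Ω c) := by
  have h : ∀ f, subst3 (M * Matrix.diagonal d) f =
      aeval (fun c => C (d c) * X c : Fin 3 → MvPolynomial (Fin 3) ℂ) (subst3 M f) := by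
    intro f
    have : (aeval (fun i => ∑ j, C ((M * Matrix.diagonal d) i j) * X j) :
        MvPolynomial (Fin 3) ℂ →ₐ[ℂ] MvPolynomial (Fin 3) ℂ) =
        (aeval (fun c => C (d c) * X c : Fin 3 → MvPolynomial (Fin 3) ℂ)).comp
          (aeval (fun i => ∑ j, C (M i j) * X j)) := by
      apply MvPolynomial.algHom_ext; intro i
      rw [AlgHom.comp_apply, aeval_X, aeval_X, map_sum]
      apply Finset.sum_congr rfl
      intro j _
      rw [map_mul, aeval_X, Matrix.mul_diagonal, C_mul, aeval_C, algebraMap_eq]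
      ring
    exact DFunLike.congr_fun this f
  simp only [pb3, h, map_sum, map_mul, Matrix.mul_diagonal, aeval_C, algebraMap_eq, Finset.mul_sum]
  apply Finset.sum_congr rfl
  intro j _
  ring

theorem final {A B Cz : MvPolynomial (Fin 3) ℂ} (M : Matrix (Fin 3) (Fin 3) ℂ) (hM : M.det ≠ 0)
    (a0 b0 c0 a1 b1 c1 a2 b2 c2 : ℂ) (ha0 : a0 ≠ 0) (hc1 : c1 ≠ 0) (ha2 : a2 ≠ 0)
    (h0 : pb3 M (OmZ A B Cz) 0 = X 1 * X 2 * (C a0 * X 1 ^ 2 + C b0 * X 1 * X 2 + C c0 * X 2 ^ 2))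
    (h1 : pb3 M (OmZ A B Cz) 1 = X 0 * X 2 * (C a1 * X 0 ^ 2 + C b1 * X 0 * X 2 + C c1 * X 2 ^ 2))
    (h2 : pb3 M (OmZ A B Cz) 2 = X 0 * X 1 * (C a2 * X 0 ^ 2 + C b2 * X 0 * X 1 + C c2 * X 1 ^ 2)) :
    LinConj3 (OmZ A B Cz) (OmZ (X 0 ^ 3) (X 1 ^ 3) (X 2 ^ 3)) := by
  have he := pb3_euler M A B Cz
  rw [h0, h1, h2] at he
  have he2 : (X 0 * X 1 * X 2 : MvPolynomial (Fin 3) ℂ) *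
    ((C a0 * X 1 ^ 2 + C b0 * X 1 * X 2 + C c0 * X 2 ^ 2) +
     (C a1 * X 0 ^ 2 + C b1 * X 0 * X 2 + C c1 * X 2 ^ 2) +
     (C a2 * X 0 ^ 2 + C b2 * X 0 * X 1 + C c2 * X 1 ^ 2)) = 0 := by
    linear_combination he
  have he3 := (mul_eq_zero.1 he2).resolve_left (by simp [X_ne_zero])
  have ev : ∀ x : Fin 3 → ℂ, _ := fun x => congrArg (eval x) he3
  have e1 := ev ![1, 0, 0]
  have e2 := ev ![0, 1, 0]
  have e3 := ev ![0, 0, 1]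
  have e4 := ev ![1, 1, 0]
  have e5 := ev ![1, 0, 1]
  have e6 := ev ![0, 1, 1]
  simp at e1 e2 e3 e4 e5 e6
  have r0 : b0 = 0 := by linear_combination e6 - e2 - e3
  have r1 : b1 = 0 := by linear_combination e5 - e1 - e3
  have r2 : b2 = 0 := by linear_combination e4 - e1 - e2
  have q1 : a1 = -a2 := by linear_combination e1
  have q2 : c2 = -a0 := by linear_combination e2
  have q3 : c0 = -c1 := by linear_combination e3
  subst r0 r1 r2 q1 q2 q3
  obtain ⟨d0, hd0⟩ := IsAlgClosed.exists_pow_nat_eq a2⁻¹ (n := 2) (by norm_num)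
  obtain ⟨d1, hd1⟩ := IsAlgClosed.exists_pow_nat_eq a0⁻¹ (n := 2) (by norm_num)
  obtain ⟨d2, hd2⟩ := IsAlgClosed.exists_pow_nat_eq c1⁻¹ (n := 2) (by norm_num)
  have n0 : d0 ≠ 0 := by rintro rfl; simp at hd0; exact ha2 hd0.symm
  have n1 : d1 ≠ 0 := by rintro rfl; simp at hd1; exact ha0 hd1.symm
  have n2 : d2 ≠ 0 := by rintro rfl; simp at hd2; exact hc1 hd2.symm
  have k0 : (C a2 * C d0 ^ 2 : MvPolynomial (Fin 3) ℂ) = 1 := by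
    rw [← C_pow, hd0, ← C_mul, mul_inv_cancel₀ ha2, C_1]
  have k1 : (C a0 * C d1 ^ 2 : MvPolynomial (Fin 3) ℂ) = 1 := by
    rw [← C_pow, hd1, ← C_mul, mul_inv_cancel₀ ha0, C_1]
  have k2 : (C c1 * C d2 ^ 2 : MvPolynomial (Fin 3) ℂ) = 1 := by
    rw [← C_pow, hd2, ← C_mul, mul_inv_cancel₀ hc1, C_1]
  refine ⟨M * Matrix.diagonal ![d0, d1, d2], d0 * d1 * d2, ?_, by positivity, ?_⟩
  · rw [isUnit_iff_ne_zero, Matrix.det_mul, Matrix.det_diagonal, Fin.prod_univ_three]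
    simp [hM, n0, n1, n2]
  · funext i
    rw [pb3_scale]
    fin_cases i
    · simp only [Fin.zero_eta]
      rw [h0]
      simp only [OmZ, map_mul, map_add, map_pow, aeval_X, aeval_C, algebraMap_eq,
        Matrix.cons_val_zero, Matrix.cons_val_one, Matrix.cons_val, C_neg, C_0, map_neg, map_zero]
      linear_combination C d0 * C d1 * C d2 * X 1 * X 2 * (k1 * X 1 ^ 2 - k2 * X 2 ^ 2)
    · simp only [Fin.mk_one]
      rw [h1]
      simp only [OmZ, map_mul, map_add, map_pow, aeval_X, aeval_C, algebraMap_eq,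
        Matrix.cons_val_zero, Matrix.cons_val_one, Matrix.cons_val, C_neg, C_0, map_neg, map_zero]
      linear_combination C d0 * C d1 * C d2 * X 0 * X 2 * (k2 * X 2 ^ 2 - k0 * X 0 ^ 2)
    · simp only [Fin.reduceFinMk]
      rw [h2]
      simp only [OmZ, map_mul, map_add, map_pow, aeval_X, aeval_C, algebraMap_eq,
        Matrix.cons_val_zero, Matrix.cons_val_one, Matrix.cons_val, C_neg, C_0, map_neg, map_zero]
      linear_combination C d0 * C d1 * C d2 * X 0 * X 1 * (k0 * X 0 ^ 2 - k1 * X 1 ^ 2)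

theorem extactic_hom {A B Cz : MvPolynomial (Fin 3) ℂ}
    (hA : A.IsHomogeneous 3) (hB : B.IsHomogeneous 3) (hC : Cz.IsHomogeneous 3) :
    (extactic A B Cz).IsHomogeneous 9 := by
  have hX0 : Zop A B Cz (X 0) = A := by simp [Zop, pderiv_X]
  have hX1 : Zop A B Cz (X 1) = B := by simp [Zop, pderiv_X]
  have hX2 : Zop A B Cz (X 2) = Cz := by simp [Zop, pderiv_X]
  have hZ : ∀ f : MvPolynomial (Fin 3) ℂ, f.IsHomogeneous 3 → (Zop A B Cz f).IsHomogeneous 5 := by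
    intro f hf
    exact ((hA.mul hf.pderiv).add (hB.mul hf.pderiv)).add (hC.mul hf.pderiv)
  have hEe : extactic A B Cz = X 0 * (B * Zop A B Cz Cz - Cz * Zop A B Cz B)
      - X 1 * (A * Zop A B Cz Cz - Cz * Zop A B Cz A)
      + X 2 * (A * Zop A B Cz B - B * Zop A B Cz A) := by
    rw [extactic, Matrix.det_fin_three]
    simp [hX0, hX1, hX2]; ring
  rw [hEe]
  have k : ∀ (i : Fin 3) (f g : MvPolynomial (Fin 3) ℂ), f.IsHomogeneous 3 → g.IsHomogeneous 3 →
      (X i * (f * Zop A B Cz g - g * Zop A B Cz f)).IsHomogeneous 9 := by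
    intro i f g hf hg
    exact (isHomogeneous_X ℂ i).mul ((hf.mul (hZ g hg)).sub (hg.mul (hZ f hf)))
  exact ((k 0 _ _ hB hC).sub (k 1 _ _ hA hC)).add (k 2 _ _ hA hB)

theorem main9 {A B Cz : MvPolynomial (Fin 3) ℂ}
    (hA : A.IsHomogeneous 3) (hB : B.IsHomogeneous 3) (hC : Cz.IsHomogeneous 3)
    (hfol : IsFolDeg 3 (OmZ A B Cz)) (hE : extactic A B Cz ≠ 0)
    (u : Fin 9 → Fin 3 → ℂ) (hu : ∀ i, InvL A B Cz (u i)) (h0 : ∀ i, u i ≠ 0)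
    (hnp : ∀ i j, i ≠ j → cr (u i) (u j) ≠ 0) :
    LinConj3 (OmZ A B Cz) (OmZ (X 0 ^ 3) (X 1 ^ 3) (X 2 ^ 3)) := by
  obtain ⟨P, ⟨⟨p, hp0, rfl⟩, hP4⟩, Q, ⟨⟨q, hq0, rfl⟩, hQ4⟩, R, ⟨⟨r, hr0, rfl⟩, hR4⟩, i, j, k,
      hiP, hiQ, hjQ, hjR, hkR, hkP, hij, hjk, hik, hPQ, hQR, hPR⟩ :=
    combi {P | (∃ p, p ≠ 0 ∧ P = inc u p) ∧ P.card = 4} (fun P hP => hP.2)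
    (by
      rintro P ⟨⟨p, hp, rfl⟩, -⟩ Q ⟨⟨q, hq, rfl⟩, -⟩ hPQ
      by_contra hc
      push Not at hc
      obtain ⟨a, ha, b, hb, hab⟩ := Finset.one_lt_card.1 hc
      rw [Finset.mem_inter] at ha hb
      exact hPQ (inc_eq hnp hp hq hab ha.1 hb.1 ha.2 hb.2))
    (by
      intro i
      obtain ⟨p, hp, hi, h4⟩ := four_point hA hB hC hfol hE u hu h0 hnp i
      exact ⟨_, ⟨⟨p, hp, rfl⟩, h4⟩, hi⟩)
  obtain ⟨κ0, hκ0, e0⟩ := (T1 hfol hE _ u hu h0 hnp p hp0 (fun t ht => mem_inc.1 ht)).2 hP4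
  obtain ⟨κ1, hκ1, e1⟩ := (T1 hfol hE _ u hu h0 hnp q hq0 (fun t ht => mem_inc.1 ht)).2 hQ4
  obtain ⟨κ2, hκ2, e2⟩ := (T1 hfol hE _ u hu h0 hnp r hr0 (fun t ht => mem_inc.1 ht)).2 hR4
  have uPQ : ∀ t, t ∈ inc u p → t ≠ i → ¬ t ∈ inc u q := fun t h1 h2 h3 =>
    hPQ (inc_eq hnp hp0 hq0 h2 h1 hiP h3 hiQ)
  have uQR : ∀ t, t ∈ inc u q → t ≠ j → ¬ t ∈ inc u r := fun t h1 h2 h3 =>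
    hQR (inc_eq hnp hq0 hr0 h2 h1 hjQ h3 hjR)
  have uPR : ∀ t, t ∈ inc u p → t ≠ k → ¬ t ∈ inc u r := fun t h1 h2 h3 =>
    hPR (inc_eq hnp hp0 hr0 h2 h1 hkP h3 hkR)
  have uQP : ∀ t, t ∈ inc u q → t ≠ i → ¬ t ∈ inc u p := fun t h1 h2 h3 => uPQ t h3 h2 h1
  have uRQ : ∀ t, t ∈ inc u r → t ≠ j → ¬ t ∈ inc u q := fun t h1 h2 h3 => uQR t h3 h2 h1
  have uRP : ∀ t, t ∈ inc u r → t ≠ k → ¬ t ∈ inc u p := fun t h1 h2 h3 => uPR t h3 h2 h1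
  simp only [mem_inc] at hiP hiQ hjQ hjR hkR hkP uPQ uQR uPR uQP uRQ uRP
  set M : Matrix (Fin 3) (Fin 3) ℂ := fun s c => ![p s, q s, r s] c with hM
  have m0 : (fun s => M s 0) = p := by funext s; simp [hM]
  have m1 : (fun s => M s 1) = q := by funext s; simp [hM]
  have m2 : (fun s => M s 2) = r := by funext s; simp [hM]
  set nu : Fin 9 → Fin 3 → ℂ := fun t c => dt (u t) (fun s => M s c) with hnu
  have v0 : ∀ t, nu t 0 = dt (u t) p := fun t => by simp only [hnu, m0]
  have v1 : ∀ t, nu t 1 = dt (u t) q := fun t => by simp only [hnu, m1]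
  have v2 : ∀ t, nu t 2 = dt (u t) r := fun t => by simp only [hnu, m2]
  have hsub : ∀ (κ : ℂ) (P : Finset (Fin 9)), subst3 M (C κ * ∏ t ∈ P, lf (u t)) =
      C κ * ∏ t ∈ P, lf (nu t) := by
    intro κ P
    have : ∀ f, subst3 M f = (aeval (fun i => ∑ j, C (M i j) * X j) :
      MvPolynomial (Fin 3) ℂ →ₐ[ℂ] MvPolynomial (Fin 3) ℂ) f := fun f => rfl
    rw [this, map_mul, map_prod, aeval_C, algebraMap_eq]
    congr 1
    exact Finset.prod_congr rfl fun t _ => subst3_lf M (u t)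
  have hdet : M.det ≠ 0 := by
    intro hd
    have : (Matrix.of ![u j, u k, u i] * M).det = nu j 0 * nu k 1 * nu i 2 := by
      have : Matrix.of ![u j, u k, u i] * M = Matrix.diagonal ![nu j 0, nu k 1, nu i 2] := by
        have hh : ∀ (w : Fin 3 → ℂ) (c : Fin 3), ∑ s, w s * M s c = dt w (fun s => M s c) := by
          intro w c; rw [sum_dt]
        clear_value nu M
        ext a b
        rw [Matrix.mul_apply]
        fin_cases a <;> fin_cases b <;> simp [hh, m0, m1, m2, v0, v1, v2, hiP, hiQ, hjQ, hjR, hkR, hkP]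
      rw [this, Matrix.det_diagonal, Fin.prod_univ_three]; simp
    rw [Matrix.det_mul, hd, mul_zero, v0, v1, v2] at this
    have a1 := uQP j hjQ hij.symm
    have a2 := uPQ k hkP hik.symm
    have a3 := uPR i hiP hik
    simp [a1, a2, a3] at this
  obtain ⟨a0, b0, c0, ha0, hc0, f0⟩ := W_form (inc u p) nu 1 2 i k (mem_inc.2 hiP) (mem_inc.2 hkP) hik hP4
    (by
      intro t ht
      rw [mem_inc] at ht
      simp [lf, Fin.sum_univ_three, v0, ht])
    (by rw [v1, hiQ]) (by rw [v2, hkR])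
    (by intro t ht hti; rw [v1]; exact uPQ t (mem_inc.1 ht) hti)
    (by intro t ht hti; rw [v2]; exact uPR t (mem_inc.1 ht) hti)
  obtain ⟨a1, b1, c1, ha1, hc1, f1⟩ := W_form (inc u q) nu 0 2 i j (mem_inc.2 hiQ) (mem_inc.2 hjQ) hij hQ4
    (by
      intro t ht
      rw [mem_inc] at ht
      simp [lf, Fin.sum_univ_three, v1, ht])
    (by rw [v0, hiP]) (by rw [v2, hjR])
    (by intro t ht hti; rw [v0]; exact uQP t (mem_inc.1 ht) hti)
    (by intro t ht hti; rw [v2]; exact uQR t (mem_inc.1 ht) hti)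
  obtain ⟨a2, b2, c2, ha2, hc2, f2⟩ := W_form (inc u r) nu 0 1 k j (mem_inc.2 hkR) (mem_inc.2 hjR) hjk.symm hR4
    (by
      intro t ht
      rw [mem_inc] at ht
      simp [lf, Fin.sum_univ_three, v2, ht])
    (by rw [v0, hkP]) (by rw [v1, hjQ])
    (by intro t ht hti; rw [v0]; exact uRP t (mem_inc.1 ht) hti)
    (by intro t ht hti; rw [v1]; exact uRQ t (mem_inc.1 ht) hti)
  refine final M hdet (κ0 * a0) (κ0 * b0) (κ0 * c0) (κ1 * a1) (κ1 * b1) (κ1 * c1)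
    (κ2 * a2) (κ2 * b2) (κ2 * c2) (mul_ne_zero hκ0 ha0) (mul_ne_zero hκ1 hc1) (mul_ne_zero hκ2 ha2) ?_ ?_ ?_
  · rw [pb3_eq, m0, e0, hsub, f0]; simp only [C_mul]; ring
  · rw [pb3_eq, m1, e1, hsub, f1]; simp only [C_mul]; ring
  · rw [pb3_eq, m2, e2, hsub, f2]; simp only [C_mul]; ring

theorem smul_of_cr_zero {u v : Fin 3 → ℂ} (hu : u ≠ 0) (h : cr u v = 0) : ∃ c : ℂ, v = c • u := by
  obtain ⟨m, hm⟩ := exists_coord_ne hu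
  refine ⟨v m / u m, ?_⟩
  have h0 := congrFun h 0
  have h1 := congrFun h 1
  have h2 := congrFun h 2
  simp [cr] at h0 h1 h2
  funext k
  simp only [Pi.smul_apply, smul_eq_mul]
  field_simp
  fin_cases m <;> fin_cases k <;> simp
  all_goals first
    | linear_combination h0
    | linear_combination -h0
    | linear_combination h1
    | linear_combination -h1
    | linear_combination h2
    | linear_combination -h2

/-- **Convex degree-3 foliations with reduced inflection divisor.**
Every convex degree-3 foliation of `ℙ²(ℂ)` whose extactic polynomial is squarefree is
linearly conjugate to the Fermat foliation `F₃`, given by the vector field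
`x³∂x + y³∂y + z³∂z` (i.e. in the chart `z = 1` by `(x³−x)dy − (y³−y)dx`). -/
theorem stmt_11 (A B Cz : MvPolynomial (Fin 3) ℂ)
    (hA : A.IsHomogeneous 3) (hB : B.IsHomogeneous 3) (hC : Cz.IsHomogeneous 3)
    (hgcd : ∀ h : MvPolynomial (Fin 3) ℂ, h ∣ A → h ∣ B → h ∣ Cz → IsUnit h)
    (hfol : IsFolDeg 3 (OmZ A B Cz))
    (hconv : ConvexFol A B Cz)
    (hred : Squarefree (extactic A B Cz)) :
    LinConj3 (OmZ A B Cz) (OmZ (X 0 ^ 3) (X 1 ^ 3) (X 2 ^ 3)) := by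

  have hE : extactic A B Cz ≠ 0 := hred.ne_zero
  obtain ⟨n, c, L, hc, hL, hprod⟩ := hconv
  have hn : n = 9 := by
    have h1 := extactic_hom hA hB hC
    have h2 : (extactic A B Cz).IsHomogeneous n := by
      rw [hprod]
      have := IsHomogeneous.prod Finset.univ L (fun _ => 1) (fun i _ => (hL i).1)
      simp at this
      exact this.C_mul c
    exact h2.inj_right h1 hE
  subst hn
  choose u hu using fun i => hom_one_eq_lf (hL i).1
  have h0 : ∀ i, u i ≠ 0 := by
    intro i h
    apply (hL i).2.1
    rw [hu i, h]; simp [lf]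
  refine main9 hA hB hC hfol hE u ?_ h0 ?_
  · intro i
    have := (hL i).2.2
    rw [LineInvZ, hu i, Zop_lf] at this
    exact this
  · intro i j hij h
    obtain ⟨r, hr⟩ := smul_of_cr_zero (h0 i) h
    have hd : L i * L i ∣ extactic A B Cz := by
      rw [hprod, ← Finset.mul_prod_erase Finset.univ L (Finset.mem_univ i),
        ← Finset.mul_prod_erase (Finset.univ.erase i) L (a := j) (by simp [hij.symm])]
      have : L j = C r * L i := by rw [hu j, hr, lf_smul, ← hu i]
      rw [this]
      exact ⟨C c * C r * ∏ x ∈ (Finset.univ.erase i).erase j, L x, by ring⟩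
    have := hred _ hd
    rw [hu i] at this
    exact (lf_irr _ (h0 i)).not_isUnit this
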